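/- Let p be a prime, a, b integers with 0 ≤ b ≤ a, and c a nonzero integer. Then the sequence e ↦ S(p^e·a + c, p^e·b), viewed in ℤ_p, converges to 0 as e → ∞. -/

import Mathlib

/-- Stirling numbers of the second kind for integer arguments:
`S(n,k) = (1/k!) ∑_{i=0}^{k} (-1)^(k-i) C(k,i) i^n` for `n, k ≥ 0` (with `0^0 = 1`),
and `S(n,k) = 0` if `n < 0` or `k < 0`. -/
def stirling2 (n k : ℤ) : ℤ :=
  if n < 0 ∨ k < 0 then 0
  else (∑ i ∈ Finset.range (k.toNat + 1),
      (-1 : ℤ) ^ (k.toNat - i) * (Nat.choose k.toNat i : ℤ) * (i : ℤ) ^ n.toNat)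
    / (Nat.factorial k.toNat : ℤ)

open PowerSeries in
/-- The generating function `∏_{i=1}^{k} 1 / (1 - i X)` of `r ↦ S(k + r, k)`. -/
noncomputable def stirlingSeries (k : ℕ) : PowerSeries ℤ :=
  ∏ i ∈ Finset.range k, PowerSeries.mk fun n => ((i : ℤ) + 1) ^ n

open PowerSeries in
theorem mk_pow_mul_one_sub_C_mul_X (x : ℤ) :
    (PowerSeries.mk fun n => x ^ n) * (1 - C x * X) = 1 := by
  ext n
  rw [mul_sub, mul_one, ← mul_assoc]
  cases n with
  | zero => simp
  | succ n =>
    rw [map_sub, coeff_succ_mul_X, coeff_mul_C]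
    simp [pow_succ, coeff_one]

open PowerSeries in
theorem derivative_mk_pow (x : ℤ) :
    derivative ℤ (PowerSeries.mk fun n => x ^ n) =
      (PowerSeries.mk fun n => x ^ n) * PowerSeries.mk fun n => x ^ (n + 1) := by
  have h := mk_pow_mul_one_sub_C_mul_X x
  have hd := congrArg (derivative ℤ) h
  have hs : (PowerSeries.mk fun n => x ^ (n + 1)) = C x * PowerSeries.mk fun n => x ^ n := by
    ext n
    rw [coeff_C_mul, coeff_mk, coeff_mk, pow_succ']
  rw [hs]
  generalize (PowerSeries.mk fun n => x ^ n) = G at *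
  have hX : derivative ℤ (1 - C x * X) = -C x := by
    simp [Derivation.leibniz]
  rw [Derivation.leibniz, hX] at hd
  simp only [smul_eq_mul, Derivation.map_one_eq_zero] at hd
  linear_combination G * hd - derivative ℤ G * h

open PowerSeries in
theorem derivative_stirlingSeries (k : ℕ) :
    derivative ℤ (stirlingSeries k) = stirlingSeries k *
      PowerSeries.mk fun n => ∑ i ∈ Finset.range k, ((i : ℤ) + 1) ^ (n + 1) := by
  induction k with
  | zero =>
    ext n
    simp [stirlingSeries]
  | succ k ih =>
    have hs : (PowerSeries.mk fun n => ∑ i ∈ Finset.range (k + 1), ((i : ℤ) + 1) ^ (n + 1)) =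
        (PowerSeries.mk fun n => ∑ i ∈ Finset.range k, ((i : ℤ) + 1) ^ (n + 1)) +
          PowerSeries.mk fun n => ((k : ℤ) + 1) ^ (n + 1) := by
      ext n
      simp [Finset.sum_range_succ]
    rw [hs]
    unfold stirlingSeries at *
    rw [Finset.prod_range_succ, Derivation.leibniz, ih, derivative_mk_pow]
    simp only [smul_eq_mul]
    ring

open PowerSeries in
theorem coeff_stirlingSeries (k r : ℕ) :
    coeff r (stirlingSeries k) = (Nat.stirlingSecond (k + r) k : ℤ) := by
  induction k generalizing r with
  | zero => cases r <;> simp [stirlingSeries, coeff_one]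
  | succ k ihk =>
    have h : stirlingSeries (k + 1) =
        stirlingSeries k + C ((k : ℤ) + 1) * (stirlingSeries (k + 1) * X) := by
      have h1 : stirlingSeries (k + 1) = stirlingSeries k * _ := Finset.prod_range_succ _ k
      have h2 := mk_pow_mul_one_sub_C_mul_X ((k : ℤ) + 1)
      rw [h1]
      linear_combination stirlingSeries k * h2
    induction r with
    | zero =>
      rw [h, map_add, ihk]
      simp [Nat.stirlingSecond_self]
    | succ r ihr =>
      rw [h, map_add, ihk, coeff_C_mul, coeff_succ_mul_X, ihr,
        show k + 1 + (r + 1) = (k + 1 + r) + 1 by ring, Nat.stirlingSecond_succ_succ,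
        show k + (r + 1) = k + 1 + r by ring]
      push_cast
      ring

open PowerSeries in
theorem dvd_mul_stirlingSecond (d : ℤ) (k r : ℕ)
    (h : ∀ j : ℕ, d ∣ ∑ i ∈ Finset.range k, ((i : ℤ) + 1) ^ (j + 1)) :
    d ∣ (r : ℤ) * (Nat.stirlingSecond (k + r) k : ℤ) := by
  cases r with
  | zero => simp
  | succ r =>
    have hc := congrArg (coeff r) (derivative_stirlingSeries k)
    rw [coeff_derivative, coeff_mul, coeff_stirlingSeries] at hc
    push_cast
    rw [mul_comm, hc]
    refine Finset.dvd_sum fun x _ => Dvd.dvd.mul_left ?_ _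
    rw [coeff_mk]
    exact h _

theorem sum_range_mul_modEq (d : ℕ) (f : ℕ → ℤ) (hf : ∀ i l, f (d * l + i) ≡ f i [ZMOD d])
    (N : ℕ) : ∑ i ∈ Finset.range (d * N), f i ≡ N * ∑ i ∈ Finset.range d, f i [ZMOD d] := by
  induction N with
  | zero => simp
  | succ N ih =>
    rw [Nat.mul_succ, Finset.sum_range_add]
    push_cast
    rw [add_one_mul]
    exact ih.add (Int.ModEq.sum fun i _ => hf i N)

theorem dvd_sum_range_pow (d t j : ℕ) :
    (d : ℤ) ∣ ∑ i ∈ Finset.range (d * (d * t)), ((i : ℤ) + 1) ^ j := by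
  refine Int.modEq_zero_iff_dvd.mp ((sum_range_mul_modEq d _ (fun i l => ?_) (d * t)).trans ?_)
  · refine Int.ModEq.pow _ (Int.ModEq.add_right _ ?_)
    push_cast
    exact Int.modEq_iff_dvd.mpr ⟨-l, by ring⟩
  · refine Int.modEq_zero_iff_dvd.mpr (Dvd.dvd.mul_right ?_ _)
    push_cast
    exact dvd_mul_right _ _

theorem sum_choose_mul_pow_eq_factorial_mul_stirlingSecond (n k : ℕ) :
    ∑ i ∈ Finset.range (k + 1), (-1 : ℤ) ^ (k - i) * (Nat.choose k i : ℤ) * (i : ℤ) ^ n =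
      (Nat.factorial k : ℤ) * (Nat.stirlingSecond n k : ℤ) := by
  have hT (n k y : ℕ) : (fwdDiff 1)^[k] (fun x : ℕ => (x : ℤ) ^ n) y =
      ∑ i ∈ Finset.range (k + 1),
        (-1 : ℤ) ^ (k - i) * (Nat.choose k i : ℤ) * ((y : ℤ) + i) ^ n := by
    rw [fwdDiff_iter_eq_sum_shift]
    simp
  induction n generalizing k with
  | zero =>
    cases k with
    | zero => simp
    | succ k =>
      have h := hT 0 (k + 1) 0
      simp only [pow_zero] at h ⊢
      rw [← h, Function.iterate_succ_apply, fwdDiff_const]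
      have h0 : (fwdDiff 1)^[k] (fun _ : ℕ => (0 : ℤ)) 0 = 0 := by
        rw [fwdDiff_iter_eq_sum_shift]
        simp
      simpa using h0
  | succ n ih =>
    cases k with
    | zero => simp
    | succ k =>
      have hshift : (fwdDiff 1)^[k] (fun x : ℕ => (x : ℤ) ^ n) 1 =
          (fwdDiff 1)^[k + 1] (fun x : ℕ => (x : ℤ) ^ n) 0 +
            (fwdDiff 1)^[k] (fun x : ℕ => (x : ℤ) ^ n) 0 := by
        rw [Function.iterate_succ_apply', fwdDiff]
        simp
      simp only [hT, Nat.cast_zero, zero_add, ih, Nat.cast_one] at hshift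
      rw [Finset.sum_range_succ', Nat.stirlingSecond_succ_succ, Nat.factorial_succ]
      have hterm : ∀ i ∈ Finset.range (k + 1),
          (-1 : ℤ) ^ (k + 1 - (i + 1)) * (Nat.choose (k + 1) (i + 1) : ℤ) *
            ((i + 1 : ℕ) : ℤ) ^ (n + 1) =
          ((k : ℤ) + 1) * ((-1 : ℤ) ^ (k - i) * (Nat.choose k i : ℤ) * (1 + (i : ℤ)) ^ n) := by
        intro i _
        have hc : ((k : ℤ) + 1) * (Nat.choose k i : ℤ) =
            (Nat.choose (k + 1) (i + 1) : ℤ) * ((i : ℤ) + 1) := by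
          exact_mod_cast Nat.add_one_mul_choose_eq k i
        rw [Nat.add_sub_add_right]
        push_cast
        rw [pow_succ, add_comm (1 : ℤ)]
        linear_combination -((-1 : ℤ) ^ (k - i) * ((i : ℤ) + 1) ^ n) * hc
      rw [Finset.sum_congr rfl hterm, ← Finset.mul_sum, hshift, Nat.factorial_succ]
      push_cast
      ring

theorem stirling2_natCast (n k : ℕ) : stirling2 n k = (Nat.stirlingSecond n k : ℤ) := by
  unfold stirling2
  rw [if_neg (by omega), Int.toNat_natCast, Int.toNat_natCast,
    sum_choose_mul_pow_eq_factorial_mul_stirlingSecond]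
  exact Int.mul_ediv_cancel_left _ (by exact_mod_cast Nat.factorial_ne_zero k)

theorem dvd_sub_mul_stirling2 (d t : ℕ) (n : ℤ) :
    (d : ℤ) ∣ (n - (d * (d * t) : ℕ)) * stirling2 n (d * (d * t) : ℕ) := by
  rcases lt_or_ge n 0 with hn | hn
  · simp [stirling2, hn]
  lift n to ℕ using hn
  rw [stirling2_natCast]
  rcases lt_or_ge n (d * (d * t)) with h | h
  · simp [Nat.stirlingSecond_eq_zero_of_lt h]
  · obtain ⟨r, rfl⟩ := Nat.exists_eq_add_of_le h
    rw [show (((d * (d * t) + r : ℕ) : ℤ) - (d * (d * t) : ℕ)) = r by push_cast; ring]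
    exact dvd_mul_stirlingSecond _ _ _ fun j => dvd_sum_range_pow d t (j + 1)

theorem padic_limit_stirling2_zero_of_c_ne_zero (p : ℕ) [Fact p.Prime] (a b c : ℤ)
    (hb : 0 ≤ b) (hba : b ≤ a) (hc : c ≠ 0) :
    Filter.Tendsto
      (fun e : ℕ => ((stirling2 ((p : ℤ) ^ e * a + c) ((p : ℤ) ^ e * b) : ℤ) : ℤ_[p]))
      Filter.atTop (nhds 0) := by
  have hdvd (e : ℕ) : ((p ^ (e / 2) : ℕ) : ℤ) ∣
      c * stirling2 ((p : ℤ) ^ e * a + c) ((p : ℤ) ^ e * b) := by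
    lift b to ℕ using hb
    have he : e = e / 2 + (e / 2 + e % 2) := by omega
    have hk : (p : ℤ) ^ e * b = (p ^ (e / 2) * (p ^ (e / 2) * (p ^ (e % 2) * b)) : ℕ) := by
      conv_lhs => rw [he, pow_add, pow_add]
      push_cast
      ring
    have h := dvd_sub_mul_stirling2 (p ^ (e / 2)) (p ^ (e % 2) * b) ((p : ℤ) ^ e * a + c)
    rw [← hk, show (p : ℤ) ^ e * a + c - (p : ℤ) ^ e * b = (p : ℤ) ^ e * (a - b) + c by ring,
      add_mul] at h
    refine (dvd_add_right (Dvd.dvd.mul_right (Dvd.dvd.mul_right ?_ _) _)).mp h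
    push_cast
    exact pow_dvd_pow _ (Nat.div_le_self e 2)
  have hc' : 0 < ‖(c : ℤ_[p])‖ := norm_pos_iff.mpr (Int.cast_ne_zero.mpr hc)
  have hp : (1 : ℝ) < p := by exact_mod_cast (Fact.out : p.Prime).one_lt
  have hlim : Filter.Tendsto (fun e : ℕ => ‖(c : ℤ_[p])‖⁻¹ * ((p : ℝ)⁻¹) ^ (e / 2))
      Filter.atTop (nhds 0) := by
    simpa using ((tendsto_pow_atTop_nhds_zero_of_lt_one (by positivity)
      (inv_lt_one_of_one_lt₀ hp)).comp (Nat.tendsto_div_const_atTop two_ne_zero)).const_mul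
        ‖(c : ℤ_[p])‖⁻¹
  refine squeeze_zero_norm (fun e => ?_) hlim
  rw [le_inv_mul_iff₀ hc', ← norm_mul, ← Int.cast_mul, inv_pow, ← zpow_natCast, ← zpow_neg]
  exact PadicInt.norm_int_le_pow_iff_dvd.mpr (by exact_mod_cast hdvd e)
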